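/- arXiv:2205.15614 — 2 statements merged into one kernel-verified Lean document; each statement's English description precedes it below -/
import Mathlib

section
/- The b-bit random quantization operator satisfies the compression property with δ = 1/τ: for every x ∈ ℝ^d, E_ξ‖Q_b(x) − x‖² ≤ (1 − 1/τ)‖x‖². -/
open MeasureTheory

noncomputable section

/-- Euclidean space `ℝ^n`. -/
abbrev Vec (n : ℕ) := EuclideanSpace ℝ (Fin n)

/-- The uniform probability measure on the unit cube `[0,1]^d`. -/
def unifCube (d : ℕ) : Measure (Fin d → ℝ) :=
  Measure.pi fun _ : Fin d => volume.restrict (Set.Icc (0 : ℝ) 1)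

lemma real_sign_mul_abs (a : ℝ) : Real.sign a * |a| = a := by
  rcases lt_trichotomy a 0 with h | rfl | h
  · simp [Real.sign_of_neg h, abs_of_neg h]
  · simp
  · simp [Real.sign_of_pos h, abs_of_pos h]

lemma floor_add_eq_ite (t : ℝ) {s : ℝ} (hs : s ∈ Set.Icc (0 : ℝ) 1) :
    ((⌊t + s⌋ : ℤ) : ℝ) = if 1 - Int.fract t ≤ s then (⌊t⌋ : ℝ) + 1 else ⌊t⌋ := by
  have h1 := Int.floor_add_fract t
  have h2 := Int.fract_lt_one t
  have h3 := Int.fract_nonneg t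
  split_ifs with h
  · have : ⌊t + s⌋ = ⌊t⌋ + 1 := by
      rw [Int.floor_eq_iff]
      push_cast
      constructor <;> linarith [hs.2]
    rw [this]
    push_cast
    rfl
  · have : ⌊t + s⌋ = ⌊t⌋ := by
      rw [Int.floor_eq_iff]
      constructor <;> linarith [hs.1]
    rw [this]

lemma floor_add_sub_sq_eq (t c : ℝ) {s : ℝ} (hs : s ∈ Set.Icc (0 : ℝ) 1) :
    (((⌊t + s⌋ : ℤ) : ℝ) - c) ^ 2 = ((⌊t⌋ : ℝ) - c) ^ 2 +
      (Set.Ici (1 - Int.fract t)).indicator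
        (fun _ => ((⌊t⌋ : ℝ) + 1 - c) ^ 2 - ((⌊t⌋ : ℝ) - c) ^ 2) s := by
  rw [floor_add_eq_ite t hs]
  simp only [Set.indicator_apply, Set.mem_Ici]
  split_ifs <;> ring

lemma integrableOn_floor_add_sub_sq (t c : ℝ) :
    IntegrableOn (fun s : ℝ => (((⌊t + s⌋ : ℤ) : ℝ) - c) ^ 2) (Set.Icc 0 1) := by
  rw [integrableOn_congr_fun (fun s hs => floor_add_sub_sq_eq t c hs) measurableSet_Icc]
  exact (integrable_const _).add ((integrable_const _).indicator measurableSet_Ici)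

/-- The second moment about `c` of the stochastic rounding of `t` (bias-variance decomposition). -/
lemma integral_floor_add_sub_sq (t c : ℝ) :
    ∫ s in Set.Icc (0 : ℝ) 1, (((⌊t + s⌋ : ℤ) : ℝ) - c) ^ 2 =
      Int.fract t * (1 - Int.fract t) + (t - c) ^ 2 := by
  have h2 := Int.fract_lt_one t
  have h3 := Int.fract_nonneg t
  have hset : Set.Ici (1 - Int.fract t) ∩ Set.Icc 0 1 = Set.Icc (1 - Int.fract t) 1 := by
    ext s
    simp only [Set.mem_inter_iff, Set.mem_Ici, Set.mem_Icc]
    constructor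
    · rintro ⟨h, -, h'⟩
      exact ⟨h, h'⟩
    · rintro ⟨h, h'⟩
      exact ⟨h, by linarith, h'⟩
  rw [setIntegral_congr_fun measurableSet_Icc (fun s hs => floor_add_sub_sq_eq t c hs),
    integral_add (integrable_const _) ((integrable_const _).indicator measurableSet_Ici),
    integral_indicator_const _ measurableSet_Ici,
    measureReal_restrict_apply measurableSet_Ici, hset]
  have hf : (⌊t⌋ : ℝ) = t - Int.fract t := by linarith [Int.floor_add_fract t]
  rw [integral_const, Real.volume_real_Icc_of_le (by linarith), measureReal_restrict_apply_univ,
    Real.volume_real_Icc_of_le zero_le_one, hf, smul_eq_mul, smul_eq_mul]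
  ring

instance : IsProbabilityMeasure (volume.restrict (Set.Icc (0 : ℝ) 1)) :=
  ⟨by simp⟩

lemma integrable_floor_add_eval_sub_sq {d : ℕ} (j : Fin d) (t c : ℝ) :
    Integrable (fun ξ : Fin d → ℝ => (((⌊t + ξ j⌋ : ℤ) : ℝ) - c) ^ 2) (unifCube d) :=
  integrable_comp_eval (μ := fun _ : Fin d => volume.restrict (Set.Icc (0 : ℝ) 1)) (i := j)
    (integrableOn_floor_add_sub_sq t c)

lemma integral_floor_add_eval_sub_sq {d : ℕ} (j : Fin d) (t c : ℝ) :
    ∫ ξ, (((⌊t + ξ j⌋ : ℤ) : ℝ) - c) ^ 2 ∂(unifCube d) =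
      Int.fract t * (1 - Int.fract t) + (t - c) ^ 2 := by
  rw [← integral_floor_add_sub_sq t c]
  exact integral_comp_eval (μ := fun _ : Fin d => volume.restrict (Set.Icc (0 : ℝ) 1)) (i := j)
    (f := fun s : ℝ => (((⌊t + s⌋ : ℤ) : ℝ) - c) ^ 2)
    (integrableOn_floor_add_sub_sq t c).aestronglyMeasurable

/-- The total variance of the stochastic rounding of a nonnegative vector. -/
lemma sum_fract_mul_one_sub_le {d : ℕ} (t : Fin d → ℝ) (ht : ∀ j, 0 ≤ t j) {B : ℝ} (hB : 0 ≤ B)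
    (hsum : ∑ j, t j ^ 2 = B ^ 2) :
    ∑ j, Int.fract (t j) * (1 - Int.fract (t j)) ≤ min (d : ℝ) (Real.sqrt d * B) := by
  refine le_min ?_ ?_
  · calc ∑ j, Int.fract (t j) * (1 - Int.fract (t j)) ≤ ∑ _j : Fin d, (1 : ℝ) := by
          refine Finset.sum_le_sum fun j _ => ?_
          nlinarith [Int.fract_lt_one (t j), Int.fract_nonneg (t j)]
      _ = d := by simp
  · calc ∑ j, Int.fract (t j) * (1 - Int.fract (t j)) ≤ ∑ j, t j := by
          refine Finset.sum_le_sum fun j _ => ?_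
          have h1 : (0 : ℝ) ≤ ⌊t j⌋ := by exact_mod_cast Int.floor_nonneg.2 (ht j)
          nlinarith [Int.floor_add_fract (t j), sq_nonneg (Int.fract (t j))]
      _ ≤ Real.sqrt d * B := by
          refine abs_le_of_sq_le_sq' ?_ (by positivity) |>.2
          rw [mul_pow, Real.sq_sqrt (Nat.cast_nonneg d), ← hsum]
          simpa using sq_sum_le_card_mul_sum_sq (s := Finset.univ) (f := t)

/-- **The `b`-bit random quantizer is a `δ = 1/τ` compression operator.** For every `x ∈ ℝ^d`,
`E_ξ ‖Q_b(x) − x‖² ≤ (1 − 1/τ) ‖x‖²`, where `ξ` is uniform on `[0,1]^d` and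
`τ = 1 + min(d/2^{2b}, √d/2^b)`. -/
theorem random_quantization_compression
    (d b : ℕ) (hd : 1 ≤ d) (hb : 1 ≤ b)
    (τ : ℝ) (hτ : τ = 1 + min ((d : ℝ) / 2 ^ (2 * b)) (Real.sqrt d / 2 ^ b))
    (Q : Vec d → (Fin d → ℝ) → Vec d)
    (hQ : ∀ z : Vec d, z ≠ 0 → ∀ (ξ : Fin d → ℝ) (j : Fin d),
      Q z ξ j = Real.sign (z j) * (‖z‖ / (2 ^ b * τ)) *
        ((⌊(2 : ℝ) ^ b * |z j| / ‖z‖ + ξ j⌋ : ℤ) : ℝ))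
    (hQ0 : ∀ ξ, Q 0 ξ = 0)
    (x : Vec d) :
    ∫ ξ, ‖Q x ξ - x‖ ^ 2 ∂(unifCube d) ≤ (1 - 1 / τ) * ‖x‖ ^ 2 := by
  have hnn : 0 ≤ min ((d : ℝ) / 2 ^ (2 * b)) (Real.sqrt d / 2 ^ b) := by positivity
  have hτ1 : 1 ≤ τ := by linarith
  have hτ0 : 0 < τ := by linarith
  rcases eq_or_ne x 0 with rfl | hx
  · simp [hQ0]
  have hn : 0 < ‖x‖ := norm_pos_iff.2 hx
  set B : ℝ := 2 ^ b with hB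
  have hB0 : 0 < B := by positivity
  set r : ℝ := ‖x‖ / (B * τ) with hr
  set t : Fin d → ℝ := fun j => B * |x j| / ‖x‖ with ht
  have ht0 : ∀ j, 0 ≤ t j := fun j => by positivity
  have hsum : ∑ j, t j ^ 2 = B ^ 2 := by
    have hx2 : ∑ j, x j ^ 2 = ‖x‖ ^ 2 := (EuclideanSpace.real_norm_sq_eq x).symm
    simp only [ht, div_pow, mul_pow, sq_abs]
    rw [← Finset.sum_div, ← Finset.mul_sum, hx2]
    field_simp
  have hpt : ∀ ξ, ‖Q x ξ - x‖ ^ 2 = ∑ j, (Real.sign (x j) ^ 2 * r ^ 2) *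
      (((⌊t j + ξ j⌋ : ℤ) : ℝ) - τ * t j) ^ 2 := fun ξ => by
    rw [EuclideanSpace.real_norm_sq_eq]
    refine Finset.sum_congr rfl fun j _ => ?_
    have hxj : x j = Real.sign (x j) * r * (τ * t j) := by
      have h : r * (τ * t j) = |x j| := by
        simp only [hr, ht]
        field_simp
      rw [mul_assoc, h, real_sign_mul_abs]
    rw [PiLp.sub_apply, hQ x hx ξ j]
    nth_rewrite 3 [hxj]
    ring
  have hV : ∑ j, Int.fract (t j) * (1 - Int.fract (t j)) ≤ B ^ 2 * (τ - 1) := by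
    refine (sum_fract_mul_one_sub_le t ht0 hB0.le hsum).trans_eq ?_
    rw [hτ, add_sub_cancel_left, mul_min_of_nonneg _ _ (sq_nonneg B), mul_comm 2 b, pow_mul, ← hB]
    congr 1 <;> field_simp
  calc ∫ ξ, ‖Q x ξ - x‖ ^ 2 ∂(unifCube d)
      = ∑ j, (Real.sign (x j) ^ 2 * r ^ 2) *
          (Int.fract (t j) * (1 - Int.fract (t j)) + (t j - τ * t j) ^ 2) := by
        simp only [hpt]
        rw [integral_finsetSum _ fun j _ =>
          (integrable_floor_add_eval_sub_sq j (t j) (τ * t j)).const_mul _]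
        simp only [integral_const_mul, integral_floor_add_eval_sub_sq]
    _ ≤ ∑ j, r ^ 2 * (Int.fract (t j) * (1 - Int.fract (t j)) + (t j - τ * t j) ^ 2) := by
        refine Finset.sum_le_sum fun j _ => ?_
        have hs : Real.sign (x j) ^ 2 ≤ 1 := by
          rcases Real.sign_apply_eq (x j) with h | h | h <;> rw [h] <;> norm_num
        have h1 : 0 ≤ 1 - Int.fract (t j) := by linarith [Int.fract_lt_one (t j)]
        have h2 := Int.fract_nonneg (t j)
        refine mul_le_mul_of_nonneg_right ?_ (by positivity)
        exact mul_le_of_le_one_left (sq_nonneg r) hs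
    _ = r ^ 2 * (∑ j, Int.fract (t j) * (1 - Int.fract (t j)) + (1 - τ) ^ 2 * B ^ 2) := by
        rw [← Finset.mul_sum, Finset.sum_add_distrib, ← hsum, Finset.mul_sum]
        congr 2
        exact Finset.sum_congr rfl fun j _ => by ring
    _ ≤ r ^ 2 * (B ^ 2 * (τ - 1) + (1 - τ) ^ 2 * B ^ 2) := by gcongr
    _ = (1 - 1 / τ) * ‖x‖ ^ 2 := by
        rw [hr]
        field_simp
        ring
end
end

section
/- For every θ ∈ ℝ^d the maximizer λ*(θ) = argmax_{λ∈Δ^{m−1}} g(θ,λ) is unique, and the map θ ↦ λ*(θ) is κ-Lipschitz with κ = L/μ: ‖λ*(θ) − λ*(θ')‖ ≤ κ ‖θ − θ'‖ for all θ, θ' ∈ ℝ^d. -/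
open Finset

noncomputable section

/-- The probability simplex `Δ^{m-1} ⊆ ℝ^m`. -/
def probSimplex (m : ℕ) : Set (Vec m) := {l | (∀ i, 0 ≤ l i) ∧ ∑ i, l i = 1}

/-- Partial gradient in the first (primal) variable. -/
def gradFst {d m : ℕ} (f : Vec d → Vec m → ℝ) (θ : Vec d) (l : Vec m) : Vec d :=
  gradient (fun θ' => f θ' l) θ

/-- Partial gradient in the second (dual) variable. -/
def gradSnd {d m : ℕ} (f : Vec d → Vec m → ℝ) (θ : Vec d) (l : Vec m) : Vec m :=
  gradient (fun l' => f θ l') l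

/-- `f` is differentiable and its joint gradient `(∇_θ f, ∇_λ f)` is `L`-Lipschitz
(in the `ℓ²` product metric): `L`-smoothness. -/
def LSmoothPair {d m : ℕ} (L : ℝ) (f : Vec d → Vec m → ℝ) : Prop :=
  (∀ l, Differentiable ℝ fun θ => f θ l) ∧ (∀ θ, Differentiable ℝ (f θ)) ∧
    ∀ θ θ' l l', ‖gradFst f θ l - gradFst f θ' l'‖ ^ 2 + ‖gradSnd f θ l - gradSnd f θ' l'‖ ^ 2
      ≤ L ^ 2 * (‖θ - θ'‖ ^ 2 + ‖l - l'‖ ^ 2)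

lemma probSimplex_eq_image (m : ℕ) :
    probSimplex m = WithLp.toLp 2 '' stdSimplex ℝ (Fin m) := by
  ext l
  constructor
  · rintro ⟨h0, h1⟩
    exact ⟨WithLp.ofLp l, ⟨h0, h1⟩, rfl⟩
  · rintro ⟨v, ⟨h0, h1⟩, rfl⟩
    exact ⟨h0, h1⟩

lemma isCompact_probSimplex (m : ℕ) : IsCompact (probSimplex m) := by
  rw [probSimplex_eq_image]
  exact (isCompact_stdSimplex ℝ (Fin m)).image (PiLp.continuous_toLp 2 _)

lemma probSimplex_nonempty {m : ℕ} (hm : 1 ≤ m) : (probSimplex m).Nonempty := by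
  rw [probSimplex_eq_image]
  exact ⟨_, Set.mem_image_of_mem _ (single_mem_stdSimplex ℝ (⟨0, hm⟩ : Fin m))⟩

section FirstOrder

variable {E : Type*} [NormedAddCommGroup E] [InnerProductSpace ℝ E] [CompleteSpace E]
  {s : Set E} {f : E → ℝ} {c : ℝ} {x y : E}

/-- First-order upper bound for a strongly concave function. -/
lemma StrongConcaveOn.le_inner_gradient (hf : StrongConcaveOn s c f) (hx : x ∈ s) (hy : y ∈ s)
    (hd : DifferentiableAt ℝ f x) :
    f y - f x + c / 2 * ‖x - y‖ ^ 2 ≤ inner ℝ (gradient f x) (y - x) := by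
  have hderiv : HasDerivAt (fun t : ℝ => f (x + t • (y - x)))
      (inner ℝ (gradient f x) (y - x)) 0 := by
    have h := (hd.hasGradientAt.hasFDerivAt).hasLineDerivAt (y - x)
    simpa [HasLineDerivAt] using h
  have hlim := hderiv.hasDerivWithinAt (s := Set.Ioi 0)
  rw [hasDerivWithinAt_iff_tendsto_slope' (by simp)] at hlim
  have hlim' : Filter.Tendsto (fun t : ℝ => f y - f x + (1 - t) * (c / 2 * ‖x - y‖ ^ 2))
      (nhdsWithin 0 (Set.Ioi 0)) (nhds (f y - f x + c / 2 * ‖x - y‖ ^ 2)) := by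
    have h : Continuous fun t : ℝ => f y - f x + (1 - t) * (c / 2 * ‖x - y‖ ^ 2) := by fun_prop
    simpa using (h.tendsto 0).mono_left nhdsWithin_le_nhds
  refine le_of_tendsto_of_tendsto hlim' hlim ?_
  filter_upwards [Ioo_mem_nhdsGT (zero_lt_one' ℝ)] with t ht
  have h := hf.2 hx hy (sub_nonneg.2 ht.2.le) ht.1.le (by ring)
  have hpt : (1 - t) • x + t • y = x + t • (y - x) := by module
  rw [hpt] at h
  simp only [smul_eq_mul] at h
  simp only [slope_def_field, zero_smul, add_zero, sub_zero]
  rw [le_div_iff₀ ht.1]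
  linarith

/-- Variational inequality at a maximizer over a convex set. -/
lemma IsMaxOn.inner_gradient_nonpos (hmax : IsMaxOn f s x) (hs : Convex ℝ s) (hx : x ∈ s)
    (hy : y ∈ s) (hd : DifferentiableAt ℝ f x) :
    inner ℝ (gradient f x) (y - x) ≤ 0 := by
  have h := hmax.localize.hasFDerivWithinAt_nonpos
    hd.hasGradientAt.hasFDerivAt.hasFDerivWithinAt
    (sub_mem_posTangentConeAt_of_segment_subset (hs.segment_subset hx hy))
  simpa using h

/-- Maximizers of two functions, one of them strongly concave, differ by at most the gap of the
gradients divided by the modulus. -/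
lemma StrongConcaveOn.mul_norm_sub_le_of_isMaxOn {f' : E → ℝ} (hf' : StrongConcaveOn s c f')
    (hx : x ∈ s) (hy : y ∈ s) (hxmax : IsMaxOn f s x) (hymax : IsMaxOn f' s y)
    (hdf : DifferentiableAt ℝ f x) (hdf' : Differentiable ℝ f') :
    c * ‖x - y‖ ≤ ‖gradient f' x - gradient f x‖ := by
  have h1 := hf'.le_inner_gradient hx hy (hdf' x)
  have h2 := hf'.le_inner_gradient hy hx (hdf' y)
  have h3 := hxmax.inner_gradient_nonpos hf'.1 hx hy hdf
  have h4 := hymax.inner_gradient_nonpos hf'.1 hy hx (hdf' y)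
  have h5 := real_inner_le_norm (gradient f' x - gradient f x) (y - x)
  rw [inner_sub_left] at h5
  rw [norm_sub_rev y x] at h2 h5
  rcases (norm_nonneg (x - y)).eq_or_lt with h0 | h0
  · rw [← h0, mul_zero]
    exact norm_nonneg _
  · refine le_of_mul_le_mul_right ?_ h0
    nlinarith

end FirstOrder

lemma LSmoothPair.norm_gradSnd_sub_le {d m : ℕ} {L : ℝ} {f : Vec d → Vec m → ℝ}
    (hf : LSmoothPair L f) (hL : 0 ≤ L) (θ θ' : Vec d) (l : Vec m) :
    ‖gradSnd f θ l - gradSnd f θ' l‖ ≤ L * ‖θ - θ'‖ := by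
  have h := hf.2.2 θ θ' l l
  rw [sub_self, norm_zero] at h
  refine abs_le_of_sq_le_sq' ?_ (by positivity) |>.2
  nlinarith [sq_nonneg ‖gradFst f θ l - gradFst f θ' l‖]

/-- **Existence, uniqueness and `κ`-Lipschitzness of the best-response map.** For an `L`-smooth
function `g(θ,λ)` which is `μ`-strongly concave in `λ`, the maximizer `λ*(θ)` of `g(θ,·)` over
the simplex exists, is unique, and is a `κ = L/μ` Lipschitz function of `θ`. -/
theorem best_response_unique_and_lipschitz
    {d m : ℕ} (hd : 1 ≤ d) (hm : 1 ≤ m)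
    (g : Vec d → Vec m → ℝ) (L μc : ℝ) (hL : 0 < L) (hμc : 0 < μc)
    (hsmooth : LSmoothPair L g)
    (hconc : ∀ θ, StrongConcaveOn (probSimplex m) μc (g θ)) :
    ∃ lstar : Vec d → Vec m,
      (∀ θ, lstar θ ∈ probSimplex m ∧ IsMaxOn (g θ) (probSimplex m) (lstar θ)) ∧
      (∀ θ, ∀ l ∈ probSimplex m, IsMaxOn (g θ) (probSimplex m) l → l = lstar θ) ∧
      (∀ θ θ', ‖lstar θ - lstar θ'‖ ≤ (L / μc) * ‖θ - θ'‖) := by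
  choose lstar hmem hmax using fun θ =>
    (isCompact_probSimplex m).exists_isMaxOn (probSimplex_nonempty hm)
      (hsmooth.2.1 θ).continuous.continuousOn
  refine ⟨lstar, fun θ => ⟨hmem θ, hmax θ⟩, fun θ l hl hlmax =>
    ((hconc θ).strictConcaveOn hμc).eq_of_isMaxOn hlmax (hmax θ) hl (hmem θ), fun θ θ' => ?_⟩
  have h := (hconc θ').mul_norm_sub_le_of_isMaxOn (hmem θ) (hmem θ') (hmax θ) (hmax θ')
    (hsmooth.2.1 θ _) (hsmooth.2.1 θ')
  have h' := hsmooth.norm_gradSnd_sub_le hL.le θ' θ (lstar θ)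
  rw [norm_sub_rev θ' θ] at h'
  rw [div_mul_eq_mul_div, le_div_iff₀ hμc, mul_comm]
  exact h.trans h'
end
end
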